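/- arXiv:0712.4395 — 6 statements merged into one kernel-verified Lean document; each statement's English description precedes it below -/
import Mathlib

section
/- Assume (·|·) is nondegenerate and dim t = r. For every λ ∈ t and every invertible form-preserving linear map w on t, the image V_{(λ,w)} of the linear map μ_{(λ,w)} is an (r+1)-dimensional linear subspace of E on which q vanishes identically, and it is a maximal totally isotropic subspace: any linear subspace M of E with V_{(λ,w)} ⊆ M on which q vanishes identically equals V_{(λ,w)}. -/
/-- The linear map `(u, ξ) ↦ (u, ξ, w⁻¹ (ξ - u l), B ξ l - (u / 2) B l l)`. -/
noncomputable def isotropicEmbedding {t : Type*} [AddCommGroup t] [Module ℂ t]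
    (B : t →ₗ[ℂ] t →ₗ[ℂ] ℂ) (l : t) (w : t ≃ₗ[ℂ] t) :
    ℂ × t →ₗ[ℂ] ℂ × t × t × ℂ where
  toFun p := (p.1, p.2, w.symm (p.2 - p.1 • l), B p.2 l - p.1 / 2 * B l l)
  map_add' p p' := by
    ext
    · simp
    · simp
    · simp only [Prod.fst_add, Prod.snd_add, ← map_add, Prod.mk_add_mk]
      congr 1
      module
    · simp only [Prod.fst_add, Prod.snd_add, map_add, LinearMap.add_apply, Prod.mk_add_mk]
      ring
  map_smul' c p := by
    ext
    · simp
    · simp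
    · simp [smul_sub, mul_smul]
    · simp only [Prod.smul_fst, Prod.smul_snd, map_smul, LinearMap.smul_apply, smul_eq_mul,
        RingHom.id_apply, Prod.smul_mk]
      ring

theorem isotropicEmbedding_injective {t : Type*} [AddCommGroup t] [Module ℂ t]
    (B : t →ₗ[ℂ] t →ₗ[ℂ] ℂ) (l : t) (w : t ≃ₗ[ℂ] t) :
    Function.Injective (isotropicEmbedding B l w) := by
  intro p p' h
  have h₁ := congrArg (fun z : ℂ × t × t × ℂ => z.1) h
  have h₂ := congrArg (fun z : ℂ × t × t × ℂ => z.2.1) h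
  exact Prod.ext h₁ h₂

/-- The image V_{(λ,w)} of μ_{(λ,w)} is an (r+1)-dimensional linear
subspace of E on which q vanishes identically, and it is a maximal totally
isotropic subspace. -/
theorem stmt4
    (t : Type*) [AddCommGroup t] [Module ℂ t] [FiniteDimensional ℂ t]
    (B : t →ₗ[ℂ] t →ₗ[ℂ] ℂ) (hBsymm : ∀ x y : t, B x y = B y x)
    (hBnd : ∀ x : t, (∀ y : t, B x y = 0) → x = 0)
    (q : ℂ × t × t × ℂ → ℂ)
    (hq : ∀ (u : ℂ) (ξ η : t) (v : ℂ),
      q (u, ξ, η, v) = B ξ ξ - B η η - 2 * u * v)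
    (l : t) (w : t ≃ₗ[ℂ] t) (hw : ∀ x y : t, B (w x) (w y) = B x y) :
    ∃ V : Submodule ℂ (ℂ × t × t × ℂ),
      (V : Set (ℂ × t × t × ℂ)) =
        {z | ∃ (u : ℂ) (ξ : t),
          z = (u, ξ, w.symm (ξ - u • l), B ξ l - u / 2 * B l l)} ∧
      Module.finrank ℂ V = Module.finrank ℂ t + 1 ∧
      (∀ x ∈ V, q x = 0) ∧
      (∀ M : Submodule ℂ (ℂ × t × t × ℂ),
        V ≤ M → (∀ x ∈ M, q x = 0) → M = V) := by
  have hw' (x y : t) : B (w.symm x) (w.symm y) = B x y := by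
    simpa using (hw (w.symm x) (w.symm y)).symm
  have hq0 (u : ℂ) (ξ : t) : q (isotropicEmbedding B l w (u, ξ)) = 0 := by
    change q (u, ξ, w.symm (ξ - u • l), B ξ l - u / 2 * B l l) = 0
    rw [hq, hw']
    simp only [map_sub, map_smul, LinearMap.sub_apply, LinearMap.smul_apply, smul_eq_mul,
      hBsymm l ξ]
    ring
  refine ⟨LinearMap.range (isotropicEmbedding B l w), ?_, ?_, ?_, ?_⟩
  · ext z
    constructor
    · rintro ⟨⟨u, ξ⟩, rfl⟩
      exact ⟨u, ξ, rfl⟩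
    · rintro ⟨u, ξ, rfl⟩
      exact ⟨(u, ξ), rfl⟩
  · rw [LinearMap.finrank_range_of_inj (isotropicEmbedding_injective B l w),
      Module.finrank_prod, Module.finrank_self, add_comm]
  · rintro _ ⟨⟨u, ξ⟩, rfl⟩
    exact hq0 u ξ
  · intro M hVM hM
    refine le_antisymm ?_ hVM
    rintro ⟨u, ξ, η, v⟩ hz
    obtain ⟨η', hη⟩ : ∃ η', η' = η - w.symm (ξ - u • l) := ⟨_, rfl⟩
    obtain ⟨v', hv⟩ : ∃ v', v' = v - (B ξ l - u / 2 * B l l) := ⟨_, rfl⟩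
    have hd : ((0, 0, η', v') : ℂ × t × t × ℂ) ∈ M := by
      have h := M.sub_mem hz (hVM ⟨(u, ξ), rfl⟩)
      simpa [isotropicEmbedding, hη, hv] using h
    have hd0 : B η' η' = 0 := by simpa [hq] using hM _ hd
    have key (a : ℂ) (y : t) : B η' y + a * v' = 0 := by
      have h1 := hM _ (M.add_mem hd (hVM ⟨(a, w y + a • l), rfl⟩))
      have h2 := hq0 a (w y + a • l)
      simp only [isotropicEmbedding, LinearMap.coe_mk, AddHom.coe_mk, Prod.mk_add_mk,
        add_sub_cancel_right, LinearEquiv.symm_apply_apply, zero_add, hq] at h1 h2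
      have h3 : B (η' + y) (η' + y) = 2 * B η' y + B y y := by
        simp only [map_add, LinearMap.add_apply, hBsymm y η', hd0]
        ring
      linear_combination (h2 - h1 - h3) / 2
    have hη0 : η' = 0 := hBnd _ fun y => by simpa using key 0 y
    have hv0 : v' = 0 := by simpa using key 1 0
    refine ⟨(u, ξ), ?_⟩
    rw [hη0] at hη
    rw [hv0] at hv
    change (u, ξ, w.symm (ξ - u • l), B ξ l - u / 2 * B l l) = _
    rw [← sub_eq_zero.mp hη.symm, ← sub_eq_zero.mp hv.symm]
end

section
/- Let r ≥ 1 and let W be any subgroup of the group of linear automorphisms of ℂ^r preserving the standard bilinear form. A polynomial p ∈ ℂ[u, x₁,…,x_r, y₁,…,y_r, v] vanishes at the point (u, ξ, w⁻¹(ξ − uλ), ξ·λ − (u/2)(λ·λ)) for every u ∈ ℂ, ξ ∈ ℂ^r, λ ∈ ℤ^r and w ∈ W if and only if p vanishes at every point (u,x,y,v) ∈ ℂ^{2r+2} satisfying x·x − y·y − 2uv = 0. (Equivalently: the Zariski closure of the fixed point arrangement ⋃_{(λ,w)} V_{(λ,w)} is exactly the quadric cone {q = 0}.) -/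
/-- The point (u, x, y, v) of ℂ^{2r+2} = ℂ × ℂ^r × ℂ^r × ℂ, as an assignment of
values to the 2r+2 polynomial variables. -/
def quadricPoint (r : ℕ) (u : ℂ) (x y : Fin r → ℂ) (v : ℂ) :
    Unit ⊕ Fin r ⊕ Fin r ⊕ Unit → ℂ :=
  Sum.elim (fun _ => u) (Sum.elim x (Sum.elim y (fun _ => v)))

theorem continuous_quadricPoint {r : ℕ} {u v : ℂ → ℂ} {x y : ℂ → Fin r → ℂ}
    (hu : Continuous u) (hx : Continuous x) (hy : Continuous y) (hv : Continuous v) :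
    Continuous fun t => quadricPoint r (u t) (x t) (y t) (v t) := by
  refine continuous_pi ?_
  rintro (_ | i | i | _)
  · exact hu
  · exact (continuous_apply i).comp hx
  · exact (continuous_apply i).comp hy
  · exact hv

/-- A polynomial vanishing on the points of the quadric cone with `u ≠ 0` vanishes at the limit of
any continuous curve of such points. -/
theorem eval_quadricPoint_eq_zero_of_curve {r : ℕ}
    {p : MvPolynomial (Unit ⊕ Fin r ⊕ Fin r ⊕ Unit) ℂ}
    (h : ∀ (u : ℂ) (x y : Fin r → ℂ) (v : ℂ), u ≠ 0 →
      (∑ i, x i * x i) - (∑ i, y i * y i) - 2 * u * v = 0 →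
      MvPolynomial.eval (quadricPoint r u x y v) p = 0)
    {u v : ℂ → ℂ} {x y : ℂ → Fin r → ℂ}
    (hu : Continuous u) (hx : Continuous x) (hy : Continuous y) (hv : Continuous v)
    (hne : ∀ t ≠ 0, u t ≠ 0)
    (hq : ∀ t, (∑ i, x t i * x t i) - (∑ i, y t i * y t i) - 2 * u t * v t = 0) :
    MvPolynomial.eval (quadricPoint r (u 0) (x 0) (y 0) (v 0)) p = 0 := by
  have hc : Continuous fun t =>
      MvPolynomial.eval (quadricPoint r (u t) (x t) (y t) (v t)) p :=
    (MvPolynomial.continuous_eval p).comp (continuous_quadricPoint hu hx hy hv)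
  exact congrFun (hc.ext_on (dense_compl_singleton (0 : ℂ)) continuous_const
    fun t ht => h _ _ _ _ (hne t ht) (hq t)) 0

/-- The points of the quadric cone with `u ≠ 0` are Zariski dense in it. -/
theorem eval_quadricPoint_eq_zero_of_forall_ne {r : ℕ} (hr : 1 ≤ r)
    {p : MvPolynomial (Unit ⊕ Fin r ⊕ Fin r ⊕ Unit) ℂ}
    (h : ∀ (u : ℂ) (x y : Fin r → ℂ) (v : ℂ), u ≠ 0 →
      (∑ i, x i * x i) - (∑ i, y i * y i) - 2 * u * v = 0 →
      MvPolynomial.eval (quadricPoint r u x y v) p = 0)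
    (u : ℂ) (x y : Fin r → ℂ) (v : ℂ)
    (hq : (∑ i, x i * x i) - (∑ i, y i * y i) - 2 * u * v = 0) :
    MvPolynomial.eval (quadricPoint r u x y v) p = 0 := by
  rcases ne_or_eq u 0 with hu | rfl
  · exact h u x y v hu hq
  have line (a b : Fin r → ℂ) (hab : (∑ i, x i * a i) - ∑ i, y i * b i = v) :
      MvPolynomial.eval (quadricPoint r 0 x y v) p = 0 := by
    have := eval_quadricPoint_eq_zero_of_curve h (u := fun t => t) (x := fun t => x + t • a)
      (y := fun t => y + t • b)
      (v := fun t => v + t * (((∑ i, a i * a i) - ∑ i, b i * b i) / 2))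
      (by fun_prop) (by fun_prop) (by fun_prop) (by fun_prop) (fun _ ht => ht) ?_
    · simpa using this
    intro t
    have expand (z c : Fin r → ℂ) : ∑ i, (z + t • c) i * (z + t • c) i =
        (∑ i, z i * z i) + 2 * t * (∑ i, z i * c i) + t ^ 2 * ∑ i, c i * c i := by
      simp only [Finset.mul_sum, ← Finset.sum_add_distrib, Pi.add_apply, Pi.smul_apply, smul_eq_mul]
      exact Finset.sum_congr rfl fun i _ => by ring
    rw [expand, expand]
    linear_combination hq + 2 * t * hab
  by_cases hx : ∃ i, x i ≠ 0
  · obtain ⟨i, hi⟩ := hx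
    exact line (Pi.single i (v / x i)) 0 (by simp [Pi.single_apply, mul_div_cancel₀, hi])
  by_cases hy : ∃ i, y i ≠ 0
  · obtain ⟨i, hi⟩ := hy
    exact line 0 (Pi.single i (-(v / y i))) (by simp [Pi.single_apply, mul_div_cancel₀, hi])
  push Not at hx hy
  obtain rfl : x = 0 := funext hx
  obtain rfl : y = 0 := funext hy
  rcases eq_or_ne v 0 with rfl | hv
  · exact eval_quadricPoint_eq_zero_of_curve h (u := fun t => t) (x := fun _ => 0)
      (y := fun _ => 0) (v := fun _ => 0) (by fun_prop) (by fun_prop) (by fun_prop) (by fun_prop)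
      (fun _ ht => ht) (by simp)
  · have := eval_quadricPoint_eq_zero_of_curve h (u := fun t => t ^ 2 / (2 * v))
      (x := fun t => t • Pi.single ⟨0, hr⟩ 1) (y := fun _ => 0) (v := fun _ => v)
      (by fun_prop) (by fun_prop) (by fun_prop) (by fun_prop)
      (fun t ht => div_ne_zero (pow_ne_zero 2 ht) (mul_ne_zero two_ne_zero hv)) (fun t => by simp [Pi.single_apply]; field_simp; ring)
    simpa using this

/-- A polynomial vanishing on the arrangement for integral `l` vanishes on it for complex `l`. -/
theorem eval_quadricPoint_eq_zero_of_int {r : ℕ}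
    {p : MvPolynomial (Unit ⊕ Fin r ⊕ Fin r ⊕ Unit) ℂ} (u : ℂ) (ξ : Fin r → ℂ)
    (h : ∀ l : Fin r → ℤ, MvPolynomial.eval (quadricPoint r u ξ (ξ - u • fun i => (l i : ℂ))
      ((∑ i, ξ i * (l i : ℂ)) - u / 2 * ∑ i, (l i : ℂ) * (l i : ℂ))) p = 0)
    (l : Fin r → ℂ) :
    MvPolynomial.eval (quadricPoint r u ξ (ξ - u • l)
      ((∑ i, ξ i * l i) - u / 2 * ∑ i, l i * l i)) p = 0 := by
  let g : Unit ⊕ Fin r ⊕ Fin r ⊕ Unit → MvPolynomial (Fin r) ℂ :=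
    Sum.elim (fun _ => .C u) (Sum.elim (fun i => .C (ξ i)) (Sum.elim
      (fun i => .C (ξ i) - .C u * .X i)
      (fun _ => (∑ i, .C (ξ i) * .X i) - .C (u / 2) * ∑ i, .X i * .X i)))
  have hg (m : Fin r → ℂ) : MvPolynomial.eval m (MvPolynomial.bind₁ g p) =
      MvPolynomial.eval (quadricPoint r u ξ (ξ - u • m)
        ((∑ i, ξ i * m i) - u / 2 * ∑ i, m i * m i)) p := by
    rw [← MvPolynomial.coe_aeval_eq_eval, RingHom.coe_coe, MvPolynomial.aeval_bind₁,
      MvPolynomial.aeval_eq_eval]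
    congr 2
    funext j
    rcases j with _ | i | i | _ <;> simp [g, quadricPoint]
  have hzero : MvPolynomial.bind₁ g p = 0 := by
    refine MvPolynomial.funext_set (fun _ => Set.range ((↑) : ℤ → ℂ))
      (fun _ => Set.infinite_range_of_injective Int.cast_injective) fun m hm => ?_
    choose k hk using fun i => hm i (Set.mem_univ i)
    obtain rfl : (fun i => (k i : ℂ)) = m := funext hk
    rw [hg, h, map_zero]
  rw [← hg, hzero, map_zero]

/-- A polynomial p in the variables (u, x₁,…,x_r, y₁,…,y_r, v) vanishes
on the fixed point arrangement ⋃_{(λ,w)} V_{(λ,w)} (λ ∈ ℤ^r, w ∈ W) if and only if it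
vanishes on the quadric cone {x·x − y·y − 2uv = 0}; i.e. the Zariski closure of the
fixed point arrangement is exactly the quadric cone. -/
theorem stmt6 (r : ℕ) (hr : 1 ≤ r)
    (W : Subgroup ((Fin r → ℂ) ≃ₗ[ℂ] (Fin r → ℂ)))
    (hW : ∀ w ∈ W, ∀ x y : Fin r → ℂ, ∑ i, w x i * w y i = ∑ i, x i * y i)
    (p : MvPolynomial (Unit ⊕ Fin r ⊕ Fin r ⊕ Unit) ℂ) :
    (∀ (u : ℂ) (ξ : Fin r → ℂ) (l : Fin r → ℤ), ∀ w ∈ W,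
      MvPolynomial.eval
        (quadricPoint r u ξ
          (w.symm (ξ - u • fun i => (l i : ℂ)))
          ((∑ i, ξ i * (l i : ℂ)) - u / 2 * ∑ i, (l i : ℂ) * (l i : ℂ))) p = 0)
    ↔
    (∀ (u : ℂ) (x y : Fin r → ℂ) (v : ℂ),
      (∑ i, x i * x i) - (∑ i, y i * y i) - 2 * u * v = 0 →
      MvPolynomial.eval (quadricPoint r u x y v) p = 0) := by
  constructor
  · intro h
    refine eval_quadricPoint_eq_zero_of_forall_ne hr fun u x y v hu hq => ?_
    have key := eval_quadricPoint_eq_zero_of_int u x (fun l => h u x l 1 W.one_mem) (u⁻¹ • (x - y))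
    have hv : (∑ i, x i * (u⁻¹ • (x - y)) i) -
        u / 2 * ∑ i, (u⁻¹ • (x - y)) i * (u⁻¹ • (x - y)) i = v := by
      have hsum : (∑ i, x i * (u⁻¹ • (x - y)) i) -
          u / 2 * ∑ i, (u⁻¹ • (x - y)) i * (u⁻¹ • (x - y)) i =
          (2 * u)⁻¹ * ((∑ i, x i * x i) - ∑ i, y i * y i) := by
        simp only [Finset.mul_sum, ← Finset.sum_sub_distrib, Pi.sub_apply, Pi.smul_apply,
          smul_eq_mul]
        refine Finset.sum_congr rfl fun i _ => ?_
        field_simp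
        ring
      rw [hsum, sub_eq_zero.mp hq]
      field_simp
    rwa [hv, smul_inv_smul₀ hu, sub_sub_cancel] at key
  · intro h u ξ l w hw
    refine h _ _ _ _ ?_
    rw [← hW w hw (w.symm _)]
    simp only [LinearEquiv.apply_symm_apply, Finset.mul_sum, ← Finset.sum_sub_distrib, mul_sub,
      Pi.sub_apply, Pi.smul_apply, smul_eq_mul]
    exact Finset.sum_eq_zero fun i _ => by ring
end

section
/- Assume (·|·) is nondegenerate and dim t = r. A linear subspace L ⊆ E satisfies: dim L = r+1, q vanishes identically on L, and L ∩ ({0} × t × {0} × ℂ) = {0}, if and only if there exist λ ∈ t and an invertible linear map S on t preserving (·|·) such that L = {(u, Sη + uλ, η, (Sη|λ) + (u/2)|λ|²) : u ∈ ℂ, η ∈ t}; moreover such a pair (λ, S) is unique. (Hence the set of maximal isotropic subspaces of the quadric transversal to t_ξ ⊕ ℂK is a torsor under the group t ⋊ O(t) of rigid affine transformations of t.) -/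
/-- The parametrization `(u, η) ↦ (u, Sη + uλ, η, (Sη|λ) + (u/2)|λ|²)`. -/
noncomputable def isotropicParam {t : Type*} [AddCommGroup t] [Module ℂ t]
    (B : t →ₗ[ℂ] t →ₗ[ℂ] ℂ) (l : t) (S : t →ₗ[ℂ] t) : ℂ × t →ₗ[ℂ] ℂ × t × t × ℂ where
  toFun z := (z.1, S z.2 + z.1 • l, z.2, B (S z.2) l + z.1 / 2 * B l l)
  map_add' x y := by
    ext
    · simp
    · simp only [Prod.fst_add, Prod.snd_add, map_add, Prod.mk_add_mk]
      module
    · simp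
    · simp only [Prod.fst_add, Prod.snd_add, map_add, Prod.mk_add_mk, LinearMap.add_apply]
      ring
  map_smul' c x := by
    ext
    · simp
    · simp [mul_smul]
    · simp
    · simp only [Prod.smul_fst, Prod.smul_snd, map_smul, Prod.smul_mk, LinearMap.smul_apply,
        smul_eq_mul, RingHom.id_apply]
      ring

lemma isotropicParam_apply {t : Type*} [AddCommGroup t] [Module ℂ t]
    (B : t →ₗ[ℂ] t →ₗ[ℂ] ℂ) (l : t) (S : t →ₗ[ℂ] t) (u : ℂ) (η : t) :
    isotropicParam B l S (u, η) = (u, S η + u • l, η, B (S η) l + u / 2 * B l l) := rfl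

lemma isotropicParam_injective {t : Type*} [AddCommGroup t] [Module ℂ t]
    (B : t →ₗ[ℂ] t →ₗ[ℂ] ℂ) (l : t) (S : t →ₗ[ℂ] t) :
    Function.Injective (isotropicParam B l S) := by
  rintro ⟨u, η⟩ ⟨u', η'⟩ h
  simp only [isotropicParam_apply, Prod.mk.injEq] at h
  exact Prod.ext h.1 h.2.2.1

lemma isotropicParam_ext {t : Type*} [AddCommGroup t] [Module ℂ t]
    {B : t →ₗ[ℂ] t →ₗ[ℂ] ℂ} {l l' : t} {S S' : t →ₗ[ℂ] t}
    (h : (isotropicParam B l S).range = (isotropicParam B l' S').range) : l = l' ∧ S = S' := by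
  have key : ∀ (u : ℂ) (η : t), S η + u • l = S' η + u • l' := by
    intro u η
    have hmem : isotropicParam B l S (u, η) ∈ (isotropicParam B l' S').range :=
      h ▸ LinearMap.mem_range_self _ _
    obtain ⟨⟨u', η'⟩, hz⟩ := hmem
    simp only [isotropicParam_apply, Prod.mk.injEq] at hz
    obtain ⟨rfl, h2, rfl, -⟩ := hz
    exact h2.symm
  constructor
  · simpa using key 1 0
  · ext η
    simpa using key 0 η

lemma coe_eq_setOf_iff_range_isotropicParam {t : Type*} [AddCommGroup t] [Module ℂ t]
    (B : t →ₗ[ℂ] t →ₗ[ℂ] ℂ) (l : t) (S : t ≃ₗ[ℂ] t) (L : Submodule ℂ (ℂ × t × t × ℂ)) :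
    (L : Set (ℂ × t × t × ℂ)) =
        {z | ∃ (u : ℂ) (η : t), z = (u, S η + u • l, η, B (S η) l + u / 2 * B l l)} ↔
      L = (isotropicParam B l (S : t →ₗ[ℂ] t)).range := by
  rw [← SetLike.coe_set_eq (p := L)]
  have : ((isotropicParam B l (S : t →ₗ[ℂ] t)).range : Set (ℂ × t × t × ℂ)) =
      {z | ∃ (u : ℂ) (η : t), z = (u, S η + u • l, η, B (S η) l + u / 2 * B l l)} := by
    ext z
    simp [isotropicParam_apply, eq_comm]
  rw [this]

/-- A quadratic-form-preserving endomorphism preserves the polar symmetric bilinear form. -/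
lemma bilin_map_eq_of_self {t : Type*} [AddCommGroup t] [Module ℂ t]
    (B : t →ₗ[ℂ] t →ₗ[ℂ] ℂ) (hBsymm : ∀ x y : t, B x y = B y x) (S : t →ₗ[ℂ] t)
    (hS : ∀ x, B (S x) (S x) = B x x) (x y : t) : B (S x) (S y) = B x y := by
  have h := hS (x + y)
  simp only [map_add, LinearMap.add_apply] at h
  linear_combination h / 2 - hS x / 2 - hS y / 2 + hBsymm (S x) (S y) / 2 - hBsymm x y / 2

lemma exists_section_of_transversal {t : Type*} [AddCommGroup t] [Module ℂ t]
    [FiniteDimensional ℂ t] (L : Submodule ℂ (ℂ × t × t × ℂ))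
    (hdim : Module.finrank ℂ L = Module.finrank ℂ t + 1)
    (htr : ∀ x ∈ L, x.1 = 0 → x.2.2.1 = 0 → x = 0) :
    ∃ (f : ℂ × t →ₗ[ℂ] t) (g : ℂ × t →ₗ[ℂ] ℂ), ∀ u η, (u, f (u, η), η, g (u, η)) ∈ L := by
  let p : ℂ × t × t × ℂ →ₗ[ℂ] ℂ × t :=
    (LinearMap.fst ℂ _ _).prod
      (LinearMap.fst ℂ _ _ ∘ₗ LinearMap.snd ℂ _ _ ∘ₗ LinearMap.snd ℂ _ _)
  have hinj : Function.Injective (p ∘ₗ L.subtype) := by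
    rw [← LinearMap.ker_eq_bot, LinearMap.ker_eq_bot']
    intro x hx
    have hx' : (x.1.1, x.1.2.2.1) = ((0, 0) : ℂ × t) := hx
    rw [Prod.mk.injEq] at hx'
    exact Subtype.ext (htr x x.2 hx'.1 hx'.2)
  let e := LinearEquiv.ofInjectiveOfFinrankEq (p ∘ₗ L.subtype) hinj
    (by rw [hdim, Module.finrank_prod, Module.finrank_self, add_comm])
  let s : ℂ × t →ₗ[ℂ] ℂ × t × t × ℂ := L.subtype ∘ₗ (e.symm : ℂ × t →ₗ[ℂ] L)
  have hs : ∀ z, p (s z) = z := fun z => e.apply_symm_apply z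
  refine ⟨LinearMap.fst ℂ _ _ ∘ₗ LinearMap.snd ℂ _ _ ∘ₗ s,
    LinearMap.snd ℂ _ _ ∘ₗ LinearMap.snd ℂ _ _ ∘ₗ LinearMap.snd ℂ _ _ ∘ₗ s, fun u η => ?_⟩
  have hz : ((s (u, η)).1, (s (u, η)).2.2.1) = (u, η) := hs (u, η)
  rw [Prod.mk.injEq] at hz
  have hL : s (u, η) ∈ L := (e.symm (u, η)).2
  convert hL using 1
  exact Prod.ext hz.1.symm (Prod.ext rfl (Prod.ext hz.2.symm rfl))

/-- A transversal totally isotropic subspace is the range of some `isotropicParam`. -/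
lemma exists_eq_range_isotropicParam {t : Type*} [AddCommGroup t] [Module ℂ t]
    [FiniteDimensional ℂ t] (B : t →ₗ[ℂ] t →ₗ[ℂ] ℂ) (hBsymm : ∀ x y : t, B x y = B y x)
    (hBnd : ∀ x : t, (∀ y : t, B x y = 0) → x = 0) (L : Submodule ℂ (ℂ × t × t × ℂ))
    (hdim : Module.finrank ℂ L = Module.finrank ℂ t + 1)
    (hiso : ∀ u ξ η v, (u, ξ, η, v) ∈ L → B ξ ξ - B η η - 2 * u * v = 0)
    (htr : ∀ x ∈ L, x.1 = 0 → x.2.2.1 = 0 → x = 0) :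
    ∃ (l : t) (S : t ≃ₗ[ℂ] t), (∀ x y, B (S x) (S y) = B x y) ∧
      L = (isotropicParam B l (S : t →ₗ[ℂ] t)).range := by
  obtain ⟨f, g, hfg⟩ := exists_section_of_transversal L hdim htr
  let S₀ : t →ₗ[ℂ] t := f ∘ₗ LinearMap.inr ℂ ℂ t
  let l : t := f (1, 0)
  have hf : ∀ u η, f (u, η) = S₀ η + u • l := by
    intro u η
    have : (u, η) = (0, η) + u • ((1, 0) : ℂ × t) := by simp
    rw [this, map_add, map_smul]
    rfl
  have hg : ∀ u η, g (u, η) = g (1, η) + (u - 1) * g (1, 0) := by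
    intro u η
    have : (u, η) = (1, η) + (u - 1) • ((1, 0) : ℂ × t) := by simp
    rw [this, map_add, map_smul, smul_eq_mul]
  have hB : ∀ x y, B (S₀ x) (S₀ y) = B x y := by
    refine bilin_map_eq_of_self B hBsymm S₀ fun x => ?_
    have h := hiso _ _ _ _ (hfg 0 x)
    rw [hf] at h
    simpa [sub_eq_zero] using h
  have hg1 : ∀ η, g (1, η) = B (S₀ η) l + 1 / 2 * B l l := by
    intro η
    have h := hiso _ _ _ _ (hfg 1 η)
    rw [hf] at h
    simp only [one_smul, map_add, LinearMap.add_apply] at h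
    linear_combination -h / 2 + hB η η / 2 + hBsymm l (S₀ η) / 2
  have hinj : Function.Injective S₀ := by
    rw [← LinearMap.ker_eq_bot, LinearMap.ker_eq_bot']
    intro x hx
    refine hBnd x fun y => ?_
    rw [← hB, hx, map_zero, LinearMap.zero_apply]
  refine ⟨l, LinearEquiv.ofInjectiveEndo S₀ hinj, hB, ?_⟩
  symm
  apply Submodule.eq_of_le_of_finrank_eq
  · rintro _ ⟨⟨u, η⟩, rfl⟩
    have h := hfg u η
    rw [hf, hg, hg1, hg1] at h
    convert h using 1
    simp only [isotropicParam_apply, LinearEquiv.coe_coe, LinearEquiv.coe_ofInjectiveEndo,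
      map_zero, LinearMap.zero_apply, Prod.mk.injEq, true_and]
    ring
  · rw [LinearMap.finrank_range_of_inj (isotropicParam_injective _ _ _), hdim,
      Module.finrank_prod, Module.finrank_self, add_comm]


/-- A linear subspace L ⊆ E is (r+1)-dimensional, totally isotropic
for q, and transversal to {0} × t × {0} × ℂ if and only if there is a unique pair
(λ, S) with S an invertible form-preserving linear map of t such that
L = {(u, Sη + uλ, η, (Sη|λ) + (u/2)|λ|²)}. -/
theorem stmt9
    (t : Type*) [AddCommGroup t] [Module ℂ t] [FiniteDimensional ℂ t]
    (B : t →ₗ[ℂ] t →ₗ[ℂ] ℂ) (hBsymm : ∀ x y : t, B x y = B y x)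
    (hBnd : ∀ x : t, (∀ y : t, B x y = 0) → x = 0)
    (q : ℂ × t × t × ℂ → ℂ)
    (hq : ∀ (u : ℂ) (ξ η : t) (v : ℂ),
      q (u, ξ, η, v) = B ξ ξ - B η η - 2 * u * v)
    (L : Submodule ℂ (ℂ × t × t × ℂ)) :
    (Module.finrank ℂ L = Module.finrank ℂ t + 1 ∧
      (∀ x ∈ L, q x = 0) ∧
      (∀ x ∈ L, x.1 = 0 → x.2.2.1 = 0 → x = 0))
    ↔
    ∃! p : t × (t ≃ₗ[ℂ] t),
      (∀ x y : t, B (p.2 x) (p.2 y) = B x y) ∧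
      (L : Set (ℂ × t × t × ℂ)) =
        {z | ∃ (u : ℂ) (η : t),
          z = (u, p.2 η + u • p.1, η, B (p.2 η) p.1 + u / 2 * B p.1 p.1)} := by
  simp only [coe_eq_setOf_iff_range_isotropicParam]
  constructor
  · rintro ⟨hdim, hiso, htr⟩
    obtain ⟨l, S, hS, hL⟩ := exists_eq_range_isotropicParam B hBsymm hBnd L hdim
      (fun u ξ η v h => hq u ξ η v ▸ hiso _ h) htr
    refine ⟨(l, S), ⟨hS, hL⟩, ?_⟩
    rintro ⟨l', S'⟩ ⟨-, hL'⟩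
    obtain ⟨hl, hSS⟩ := isotropicParam_ext (hL'.symm.trans hL)
    exact Prod.ext hl (LinearEquiv.toLinearMap_injective hSS)
  · rintro ⟨⟨l, S⟩, ⟨hS, rfl⟩, -⟩
    refine ⟨?_, ?_, ?_⟩
    · rw [LinearMap.finrank_range_of_inj (isotropicParam_injective _ _ _),
        Module.finrank_prod, Module.finrank_self, add_comm]
    · rintro _ ⟨⟨u, η⟩, rfl⟩
      rw [isotropicParam_apply, hq]
      simp only [LinearEquiv.coe_coe, map_add, map_smul, LinearMap.add_apply,
        LinearMap.smul_apply, smul_eq_mul]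
      linear_combination hS η η + u * hBsymm l (S η)
    · rintro _ ⟨⟨u, η⟩, rfl⟩ (rfl : u = 0) (rfl : η = 0)
      exact map_zero _
end

section
/- Assume: (·|·) is nondegenerate; W acts irreducibly on t with no nonzero W-fixed vectors; Λ spans t over ℂ and contains an element λ₀ with (λ₀|λ₀) ≠ 0. On E define, for λ ∈ Λ and w ∈ W, the maps ρ₁(λ,w)(u,ξ,η,v) = (u, wξ + uλ, η, v + (wξ|λ) + (u/2)|λ|²) and ρ₂(λ,w)(u,ξ,η,v) = (u, ξ, wη + uλ, v − (wη|λ) − (u/2)|λ|²), and the involution ι(u,ξ,η,v) = (u, η, ξ, −v). If α is a linear automorphism of E such that q(α(x)) = q(x) for all x ∈ E, α ∘ ι = ι ∘ α, and α commutes with ρ₁(λ,w) and with ρ₂(λ,w) for all λ ∈ Λ and w ∈ W, then α = id or α = −id. -/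
/-- Under the stated hypotheses, a linear automorphism α of E
preserving q, commuting with the involution ι and with the two Λ⋊W-actions ρ₁, ρ₂,
is ±id. -/
theorem stmt10
    (t : Type*) [AddCommGroup t] [Module ℂ t] [FiniteDimensional ℂ t]
    (B : t →ₗ[ℂ] t →ₗ[ℂ] ℂ) (hBsymm : ∀ x y : t, B x y = B y x)
    (hBnd : ∀ x : t, (∀ y : t, B x y = 0) → x = 0)
    (W : Subgroup (t ≃ₗ[ℂ] t))
    (hW : ∀ w ∈ W, ∀ x y : t, B (w x) (w y) = B x y)
    (Λ : AddSubgroup t) (hΛ : ∀ w ∈ W, ∀ l ∈ Λ, w l ∈ Λ)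
    (hirr : ∀ M : Submodule ℂ t, (∀ w ∈ W, ∀ x ∈ M, w x ∈ M) → M = ⊥ ∨ M = ⊤)
    (hnofix : ∀ x : t, (∀ w ∈ W, w x = x) → x = 0)
    (hspan : Submodule.span ℂ (Λ : Set t) = ⊤)
    (l₀ : t) (hl₀ : l₀ ∈ Λ) (hl₀n : B l₀ l₀ ≠ 0)
    (q : ℂ × t × t × ℂ → ℂ)
    (hq : ∀ (u : ℂ) (ξ η : t) (v : ℂ),
      q (u, ξ, η, v) = B ξ ξ - B η η - 2 * u * v)
    (ρ₁ ρ₂ : t → (t ≃ₗ[ℂ] t) → ℂ × t × t × ℂ → ℂ × t × t × ℂ)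
    (hρ₁ : ∀ (l : t) (w : t ≃ₗ[ℂ] t) (u : ℂ) (ξ η : t) (v : ℂ),
      ρ₁ l w (u, ξ, η, v) = (u, w ξ + u • l, η, v + B (w ξ) l + u / 2 * B l l))
    (hρ₂ : ∀ (l : t) (w : t ≃ₗ[ℂ] t) (u : ℂ) (ξ η : t) (v : ℂ),
      ρ₂ l w (u, ξ, η, v) = (u, ξ, w η + u • l, v - B (w η) l - u / 2 * B l l))
    (ι : ℂ × t × t × ℂ → ℂ × t × t × ℂ)
    (hι : ∀ (u : ℂ) (ξ η : t) (v : ℂ), ι (u, ξ, η, v) = (u, η, ξ, -v))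
    (α : (ℂ × t × t × ℂ) ≃ₗ[ℂ] (ℂ × t × t × ℂ))
    (hαq : ∀ x : ℂ × t × t × ℂ, q (α x) = q x)
    (hαι : ∀ x : ℂ × t × t × ℂ, α (ι x) = ι (α x))
    (hαρ₁ : ∀ l ∈ Λ, ∀ w ∈ W, ∀ x : ℂ × t × t × ℂ, α (ρ₁ l w x) = ρ₁ l w (α x))
    (hαρ₂ : ∀ l ∈ Λ, ∀ w ∈ W, ∀ x : ℂ × t × t × ℂ, α (ρ₂ l w x) = ρ₂ l w (α x)) :
    (∀ x : ℂ × t × t × ℂ, α x = x) ∨ (∀ x : ℂ × t × t × ℂ, α x = -x) := by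
  have h1W : (1 : t ≃ₗ[ℂ] t) ∈ W := W.one_mem
  -- The isotropic line `(0, 0, 0, ℂ)` is preserved.
  have hev : ∃ a : ℂ, α (0, 0, 0, 1) = (0, 0, 0, a) := by
    have e₁ := hαρ₁ l₀ hl₀ 1 h1W (0, l₀, 0, 0)
    have e₂ := hαρ₂ l₀ hl₀ 1 h1W (0, 0, l₀, 0)
    rcases hx : α (0, l₀, 0, 0) with ⟨u, ξ, η, v⟩
    rcases hy : α (0, 0, l₀, 0) with ⟨u', ξ', η', v'⟩
    rcases hz : α (0, 0, 0, 1) with ⟨a₁, a₂, a₃, a₄⟩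
    have d₁ : ((0, l₀, 0, B l₀ l₀) : ℂ × t × t × ℂ)
        = (0, l₀, 0, 0) + B l₀ l₀ • (0, 0, 0, 1) := by simp
    have d₂ : ((0, 0, l₀, -B l₀ l₀) : ℂ × t × t × ℂ)
        = (0, 0, l₀, 0) + (-B l₀ l₀) • (0, 0, 0, 1) := by simp
    rw [hx, hρ₁, hρ₁] at e₁
    rw [hy, hρ₂, hρ₂] at e₂
    simp only [LinearEquiv.coe_one, id_eq, zero_smul, add_zero, zero_add, zero_div, zero_mul,
      sub_zero, zero_sub] at e₁ e₂
    rw [d₁, map_add, map_smul, hx, hz] at e₁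
    rw [d₂, map_add, map_smul, hy, hz] at e₂
    simp only [Prod.smul_mk, Prod.mk_add_mk, Prod.mk.injEq, smul_eq_mul, add_eq_left,
      mul_eq_zero, smul_eq_zero, neg_eq_zero, hl₀n, false_or] at e₁ e₂
    exact ⟨a₄, by rw [e₁.1, e₁.2.2.1, e₂.2.1]⟩
  -- The vector `(1, 0, 0, 0)` is fixed by `W` and by `ι`.
  have heu : ∃ c : ℂ, α (1, 0, 0, 0) = (c, 0, 0, 0) := by
    have e₁ := hαι (1, 0, 0, 0)
    have e₂ := fun w hw => hαρ₁ 0 Λ.zero_mem w hw (1, 0, 0, 0)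
    rcases hx : α (1, 0, 0, 0) with ⟨c, p, r, b⟩
    rw [hι, neg_zero, hx, hι] at e₁
    simp only [hρ₁, hx, map_zero, smul_zero, add_zero, mul_zero, Prod.mk.injEq, true_and,
      and_true] at e₁ e₂
    have hp : p = 0 := hnofix p fun w hw => (e₂ w hw).symm
    have hb : b = 0 := self_eq_neg.mp e₁.2.2
    exact ⟨c, by rw [hb, ← e₁.1, hp]⟩
  obtain ⟨a, hev⟩ := hev
  obtain ⟨c, heu⟩ := heu
  have hca : c * a = 1 := by
    have h := hαq ((1, 0, 0, 0) + (0, 0, 0, 1))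
    rw [map_add, heu, hev] at h
    simp only [Prod.mk_add_mk, hq, add_zero, zero_add, map_zero] at h
    linear_combination (-1 / 2) * h
  have hξΛ : ∀ l ∈ Λ, α (0, l, 0, 0) = (0, c • l, 0, (c - a) * (B l l / 2)) := by
    intro l hl
    have h := hαρ₁ l hl 1 h1W (1, 0, 0, 0)
    have d : ((1, l, 0, B l l / 2) : ℂ × t × t × ℂ)
        = (1, 0, 0, 0) + (0, l, 0, 0) + (B l l / 2) • (0, 0, 0, 1) := by simp
    rw [heu, hρ₁, hρ₁] at h
    simp only [map_zero, zero_add, LinearMap.zero_apply, one_smul, one_div] at h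
    rw [show (2 : ℂ)⁻¹ * B l l = B l l / 2 by ring, d, map_add, map_add, map_smul, heu, hev] at h
    rcases hx : α (0, l, 0, 0) with ⟨x₁, x₂, x₃, x₄⟩
    rw [hx] at h
    simp only [Prod.smul_mk, Prod.mk_add_mk, Prod.mk.injEq, smul_eq_mul, smul_zero, mul_zero,
      add_zero, zero_add, add_eq_left] at h
    obtain ⟨h₁, h₂, h₃, h₄⟩ := h
    rw [h₁, h₂, h₃, Prod.mk.injEq, Prod.mk.injEq, Prod.mk.injEq]
    exact ⟨rfl, rfl, rfl, by linear_combination h₄⟩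
  have hc : c * c = 1 := by
    have h := hαq (0, l₀, 0, 0)
    rw [hξΛ l₀ hl₀, hq, hq] at h
    simp only [map_smul, LinearMap.smul_apply, map_zero, smul_eq_mul] at h
    exact mul_right_cancel₀ hl₀n (by linear_combination h)
  have hac : a = c := by linear_combination c * hca - a * hc
  subst hac
  have hξ : ∀ x : t, α (0, x, 0, 0) = (0, a • x, 0, 0) := by
    intro x
    have hx : x ∈ Submodule.span ℂ (Λ : Set t) := hspan ▸ Submodule.mem_top
    induction hx using Submodule.span_induction with
    | mem l hl => simpa using hξΛ l hl
    | zero => rw [smul_zero]; exact map_zero α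
    | add x y _ _ hx hy =>
      have d : ((0, x + y, 0, 0) : ℂ × t × t × ℂ) = (0, x, 0, 0) + (0, y, 0, 0) := by simp
      rw [d, map_add, hx, hy]
      simp
    | smul k x _ hx =>
      have d : ((0, k • x, 0, 0) : ℂ × t × t × ℂ) = k • (0, x, 0, 0) := by simp
      rw [d, map_smul, hx]
      simp [smul_comm k a x]
  have hη : ∀ x : t, α (0, 0, x, 0) = (0, 0, a • x, 0) := by
    intro x
    have h := hαι (0, x, 0, 0)
    rwa [hι, hξ, hι, neg_zero] at h
  have hα : ∀ x, α x = a • x := by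
    rintro ⟨u, ξ, η, v⟩
    have d : ((u, ξ, η, v) : ℂ × t × t × ℂ)
        = u • (1, 0, 0, 0) + (0, ξ, 0, 0) + (0, 0, η, 0) + v • (0, 0, 0, 1) := by simp
    rw [d, map_add, map_add, map_add, map_smul, map_smul, heu, hev, hξ, hη]
    simp [mul_comm]
  rcases mul_self_eq_one_iff.mp hc with h | h
  · exact .inl fun x => by rw [hα, h, one_smul]
  · exact .inr fun x => by rw [hα, h, neg_one_smul]
end

section
/- Let f₁,…,f_r : t → ℂ be functions invariant under W (fᵢ(wξ) = fᵢ(ξ) for all w ∈ W, ξ ∈ t). On X = ℂ* × t × t × ℂ^r define, for λ ∈ Λ and w ∈ W, ρ₁(λ,w)(u,ξ,η,(vᵢ)) = (u, wξ + uλ, η, (vᵢ + (fᵢ(wξ + uλ) − fᵢ(ξ))/u)ᵢ) and ρ₂(λ,w)(u,ξ,η,(vᵢ)) = (u, ξ, wη + uλ, (vᵢ − (fᵢ(wη + uλ) − fᵢ(η))/u)ᵢ). Then ρ₁ and ρ₂ are group actions of Λ⋊W on X, and they commute: ρ₁(λ,w) ∘ ρ₂(λ',w') = ρ₂(λ',w')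 ∘ ρ₁(λ,w) for all λ,λ' ∈ Λ and w,w' ∈ W. -/
/-- With W-invariant functions f₁,…,f_r : t → ℂ, the formulas ρ₁ and ρ₂
define two commuting group actions of Λ⋊W on X = ℂ* × t × t × ℂ^r. -/
theorem stmt12
    (t : Type*) [AddCommGroup t] [Module ℂ t] [FiniteDimensional ℂ t]
    (B : t →ₗ[ℂ] t →ₗ[ℂ] ℂ) (hBsymm : ∀ x y : t, B x y = B y x)
    (W : Subgroup (t ≃ₗ[ℂ] t))
    (hW : ∀ w ∈ W, ∀ x y : t, B (w x) (w y) = B x y)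
    (Λ : AddSubgroup t) (hΛ : ∀ w ∈ W, ∀ l ∈ Λ, w l ∈ Λ)
    (r : ℕ) (f : Fin r → t → ℂ)
    (hf : ∀ i : Fin r, ∀ w ∈ W, ∀ ξ : t, f i (w ξ) = f i ξ)
    (ρ₁ ρ₂ : t → (t ≃ₗ[ℂ] t) →
      ℂˣ × t × t × (Fin r → ℂ) → ℂˣ × t × t × (Fin r → ℂ))
    (hρ₁ : ∀ (l : t) (w : t ≃ₗ[ℂ] t) (u : ℂˣ) (ξ η : t) (v : Fin r → ℂ),
      ρ₁ l w (u, ξ, η, v) = (u, w ξ + (u : ℂ) • l, η,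
        fun i => v i + (f i (w ξ + (u : ℂ) • l) - f i ξ) / (u : ℂ)))
    (hρ₂ : ∀ (l : t) (w : t ≃ₗ[ℂ] t) (u : ℂˣ) (ξ η : t) (v : Fin r → ℂ),
      ρ₂ l w (u, ξ, η, v) = (u, ξ, w η + (u : ℂ) • l,
        fun i => v i - (f i (w η + (u : ℂ) • l) - f i η) / (u : ℂ))) :
    (∀ x : ℂˣ × t × t × (Fin r → ℂ), ρ₁ 0 1 x = x) ∧
    (∀ l₁ ∈ Λ, ∀ l₂ ∈ Λ, ∀ w₁ ∈ W, ∀ w₂ ∈ W, ∀ x : ℂˣ × t × t × (Fin r → ℂ),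
      ρ₁ (l₁ + w₁ l₂) (w₁ * w₂) x = ρ₁ l₁ w₁ (ρ₁ l₂ w₂ x)) ∧
    (∀ x : ℂˣ × t × t × (Fin r → ℂ), ρ₂ 0 1 x = x) ∧
    (∀ l₁ ∈ Λ, ∀ l₂ ∈ Λ, ∀ w₁ ∈ W, ∀ w₂ ∈ W, ∀ x : ℂˣ × t × t × (Fin r → ℂ),
      ρ₂ (l₁ + w₁ l₂) (w₁ * w₂) x = ρ₂ l₁ w₁ (ρ₂ l₂ w₂ x)) ∧
    (∀ l ∈ Λ, ∀ l' ∈ Λ, ∀ w ∈ W, ∀ w' ∈ W, ∀ x : ℂˣ × t × t × (Fin r → ℂ),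
      ρ₁ l w (ρ₂ l' w' x) = ρ₂ l' w' (ρ₁ l w x)) := by
  have hmul : ∀ (l₁ l₂ ξ : t) (w₁ w₂ : t ≃ₗ[ℂ] t) (u : ℂˣ),
      (w₁ * w₂) ξ + (u : ℂ) • (l₁ + w₁ l₂) =
        w₁ (w₂ ξ + (u : ℂ) • l₂) + (u : ℂ) • l₁ := by
    intro l₁ l₂ ξ w₁ w₂ u
    rw [LinearEquiv.mul_apply, map_add, map_smul, smul_add]
    abel
  refine ⟨?_, ?_, ?_, ?_, ?_⟩
  · rintro ⟨u, ξ, η, v⟩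
    simp [hρ₁]
  · rintro l₁ - l₂ - w₁ - w₂ - ⟨u, ξ, η, v⟩
    simp only [hρ₁, hmul, Prod.mk.injEq, true_and]
    funext i
    ring
  · rintro ⟨u, ξ, η, v⟩
    simp [hρ₂]
  · rintro l₁ - l₂ - w₁ - w₂ - ⟨u, ξ, η, v⟩
    simp only [hρ₂, hmul, Prod.mk.injEq, true_and]
    funext i
    ring
  · rintro l - l' - w - w' - ⟨u, ξ, η, v⟩
    simp only [hρ₁, hρ₂, Prod.mk.injEq, true_and]
    funext i
    ring
end

section
/- Assume Λ spans t over ℂ and contains an element λ₀ with (λ₀|λ₀) ≠ 0. For the action ρ(λ,w)(u,ξ,η,v) = (u, wξ + uλ, η, v + (wξ|λ) + (u/2)|λ|²) of Λ⋊W on E, the linear span of the set {ρ(λ,w)(x) − x : λ ∈ Λ, w ∈ W, x ∈ E} equals the subspace {0} × t × {0} × ℂ of E. (Hence the coinvariants of E under the Λ⋊W-action are identified with ℂ × {0} × t × {0}.) -/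
/-- If Λ spans t and contains λ₀ with (λ₀|λ₀) ≠ 0, the linear span of
{ρ(λ,w)(x) − x} equals the subspace {0} × t × {0} × ℂ of E. -/
theorem stmt13
    (t : Type*) [AddCommGroup t] [Module ℂ t] [FiniteDimensional ℂ t]
    (B : t →ₗ[ℂ] t →ₗ[ℂ] ℂ) (hBsymm : ∀ x y : t, B x y = B y x)
    (W : Subgroup (t ≃ₗ[ℂ] t))
    (hW : ∀ w ∈ W, ∀ x y : t, B (w x) (w y) = B x y)
    (Λ : AddSubgroup t) (hΛ : ∀ w ∈ W, ∀ l ∈ Λ, w l ∈ Λ)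
    (hspan : Submodule.span ℂ (Λ : Set t) = ⊤)
    (l₀ : t) (hl₀ : l₀ ∈ Λ) (hl₀n : B l₀ l₀ ≠ 0)
    (ρ : t → (t ≃ₗ[ℂ] t) → ℂ × t × t × ℂ → ℂ × t × t × ℂ)
    (hρ : ∀ (l : t) (w : t ≃ₗ[ℂ] t) (u : ℂ) (ξ η : t) (v : ℂ),
      ρ l w (u, ξ, η, v) = (u, w ξ + u • l, η, v + B (w ξ) l + u / 2 * B l l)) :
    (Submodule.span ℂ
        {y : ℂ × t × t × ℂ | ∃ l ∈ Λ, ∃ w ∈ W, ∃ x : ℂ × t × t × ℂ,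
          y = ρ l w x - x} : Set (ℂ × t × t × ℂ)) =
      {x : ℂ × t × t × ℂ | x.1 = 0 ∧ x.2.2.1 = 0} := by
  apply Set.Subset.antisymm
  · intro y hy
    refine Submodule.span_induction
      (p := fun x _ => x.1 = 0 ∧ x.2.2.1 = 0) ?_ ?_ ?_ ?_ hy
    · rintro _ ⟨l, -, w, -, ⟨u, ξ, η, v⟩, rfl⟩
      simp [hρ]
    · simp
    · rintro x y - - ⟨hx, hx'⟩ ⟨hy, hy'⟩
      simp [hx, hx', hy, hy']
    · rintro a x - ⟨hx, hx'⟩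
      simp [hx, hx']
  · rintro ⟨u, ξ, η, v⟩ ⟨hu, hη⟩
    obtain rfl : u = 0 := hu
    obtain rfl : η = 0 := hη
    set S := Submodule.span ℂ
      {y : ℂ × t × t × ℂ | ∃ l ∈ Λ, ∃ w ∈ W, ∃ x : ℂ × t × t × ℂ, y = ρ l w x - x}
    have central_mem (c : ℂ) : ((0, 0, 0, c) : ℂ × t × t × ℂ) ∈ S := by
      have h : ((0, 0, 0, B l₀ l₀) : ℂ × t × t × ℂ) ∈ S :=
        Submodule.subset_span ⟨l₀, hl₀, 1, W.one_mem, (0, l₀, 0, 0), by simp [hρ]⟩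
      simpa [hl₀n] using S.smul_mem (c / B l₀ l₀) h
    have vector_mem (ζ : t) : ((0, ζ, 0, 0) : ℂ × t × t × ℂ) ∈ S := by
      have hζ : ζ ∈ Submodule.span ℂ (Λ : Set t) := hspan ▸ Submodule.mem_top
      induction hζ using Submodule.span_induction with
      | mem l hl =>
        have h : ((0, l, 0, 1 / 2 * B l l) : ℂ × t × t × ℂ) ∈ S :=
          Submodule.subset_span ⟨l, hl, 1, W.one_mem, (1, 0, 0, 0), by simp [hρ]⟩
        simpa [Prod.mk_zero_zero] using S.sub_mem h (central_mem (1 / 2 * B l l))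
      | zero => exact S.zero_mem
      | add x y _ _ hx hy => simpa using S.add_mem hx hy
      | smul a x _ hx => simpa using S.smul_mem a hx
    simpa using S.add_mem (vector_mem ξ) (central_mem v)
end
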